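/- For every orthonormal triple of vectors v₁, v₂, v₃ ∈ ℝ⁷ one has |α(v₁,v₂,v₃)| ≤ 1; that is, the 3-form α has comass one (it is a calibration on ℝ⁷). -/

import Mathlib

/-- The wedge `e^{f 1} ∧ ⋯ ∧ e^{f k}` of coordinate covectors on `ℝⁿ`, given by
`(e^{f 1} ∧ ⋯ ∧ e^{f k})(v₁,…,v_k) = det [vᵢ(f j)]`. -/
noncomputable def coordWedge {n k : ℕ} (f : Fin k → Fin n) :
    AlternatingMap ℝ (EuclideanSpace ℝ (Fin n)) ℝ (Fin k) :=
  (Matrix.detRowAlternating (R := ℝ) (n := Fin k)).compLinearMap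
    (LinearMap.pi fun j =>
      (EuclideanSpace.proj (f j) : EuclideanSpace ℝ (Fin n) →L[ℝ] ℝ).toLinearMap)

/-- The double point calibration `α = e¹∧e²∧e³ + e⁴∧e⁵∧e⁶` on `ℝ⁷`. -/
noncomputable def alphaDP : AlternatingMap ℝ (EuclideanSpace ℝ (Fin 7)) ℝ (Fin 3) :=
  coordWedge ![0, 1, 2] + coordWedge ![3, 4, 5]

/-- **Hadamard's inequality** for real `3 × 3` matrices. -/
theorem Matrix.det_sq_le_prod_sum_sq_fin_three (A : Matrix (Fin 3) (Fin 3) ℝ) :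
    A.det ^ 2 ≤ ∏ i, ∑ j, A i j ^ 2 := by
  have cauchy_schwarz : ∀ a b c x y z : ℝ,
      (a * x + b * y + c * z) ^ 2 ≤ (a ^ 2 + b ^ 2 + c ^ 2) * (x ^ 2 + y ^ 2 + z ^ 2) := by
    intro a b c x y z
    nlinarith [sq_nonneg (a * y - b * x), sq_nonneg (a * z - c * x), sq_nonneg (b * z - c * y)]
  have cross_sq_le : ∀ a b c x y z : ℝ,
      (b * z - c * y) ^ 2 + (c * x - a * z) ^ 2 + (a * y - b * x) ^ 2 ≤
        (a ^ 2 + b ^ 2 + c ^ 2) * (x ^ 2 + y ^ 2 + z ^ 2) := by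
    intro a b c x y z
    nlinarith [sq_nonneg (a * x + b * y + c * z)]
  simp only [Matrix.det_fin_three, Fin.prod_univ_three, Fin.sum_univ_three]
  rw [mul_assoc (A 0 0 ^ 2 + A 0 1 ^ 2 + A 0 2 ^ 2)]
  have hnonneg : 0 ≤ A 0 0 ^ 2 + A 0 1 ^ 2 + A 0 2 ^ 2 := by positivity
  refine le_trans (le_of_eq ?_) ((cauchy_schwarz (A 0 0) (A 0 1) (A 0 2) _ _ _).trans
    (mul_le_mul_of_nonneg_left
      (cross_sq_le (A 1 0) (A 1 1) (A 1 2) (A 2 0) (A 2 1) (A 2 2)) hnonneg))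
  ring

theorem Matrix.abs_det_fin_three_le_of_sum_sq_le_one (A : Matrix (Fin 3) (Fin 3) ℝ)
    (h : ∑ j, A 2 j ^ 2 ≤ 1) :
    |A.det| ≤ (∑ j, A 0 j ^ 2 + ∑ j, A 1 j ^ 2) / 2 := by
  have hadamard := A.det_sq_le_prod_sum_sq_fin_three
  rw [Fin.prod_univ_three] at hadamard
  have h₀ : 0 ≤ ∑ j, A 0 j ^ 2 := by positivity
  have h₁ : 0 ≤ ∑ j, A 1 j ^ 2 := by positivity
  refine abs_le_of_sq_le_sq ?_ (by positivity)
  nlinarith [mul_le_mul_of_nonneg_left h (mul_nonneg h₀ h₁),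
    sq_nonneg (∑ j, A 0 j ^ 2 - ∑ j, A 1 j ^ 2)]

theorem coordWedge_apply {n k : ℕ} (f : Fin k → Fin n) (v : Fin k → EuclideanSpace ℝ (Fin n)) :
    coordWedge f v = (Matrix.of fun i j => v i (f j)).det :=
  rfl

/-- The 3-form `α = e¹∧e²∧e³ + e⁴∧e⁵∧e⁶` has comass one: `|α(v₁,v₂,v₃)| ≤ 1` for every
orthonormal triple `v₁, v₂, v₃` in `ℝ⁷`. -/
theorem alphaDP_comass_le_one (v : Fin 3 → EuclideanSpace ℝ (Fin 7))
    (hv : Orthonormal ℝ v) :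
    |alphaDP v| ≤ 1 := by
  have sum_sq_le : ∀ i, ∑ j, v i (![0, 1, 2] j) ^ 2 + ∑ j, v i (![3, 4, 5] j) ^ 2 ≤ 1 := by
    intro i
    have hnorm := EuclideanSpace.real_norm_sq_eq (v i)
    rw [hv.1 i, Fin.sum_univ_seven] at hnorm
    simp only [Fin.sum_univ_three, Matrix.cons_val]
    linarith [sq_nonneg (v i 6)]
  have nonneg : ∀ (i : Fin 3) (f : Fin 3 → Fin 7), 0 ≤ ∑ j, v i (f j) ^ 2 := by
    intro i f
    positivity
  have hA := (Matrix.of fun i j => v i (![0, 1, 2] j)).abs_det_fin_three_le_of_sum_sq_le_one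
    (by simp only [Matrix.of_apply]; linarith [sum_sq_le 2, nonneg 2 ![3, 4, 5]])
  have hB := (Matrix.of fun i j => v i (![3, 4, 5] j)).abs_det_fin_three_le_of_sum_sq_le_one
    (by simp only [Matrix.of_apply]; linarith [sum_sq_le 2, nonneg 2 ![0, 1, 2]])
  simp only [Matrix.of_apply] at hA hB
  rw [alphaDP, AlternatingMap.add_apply, coordWedge_apply, coordWedge_apply]
  refine (abs_add_le _ _).trans ?_
  linarith [sum_sq_le 0, sum_sq_le 1]
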